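/- Let R be a commutative local ring and let M₁, M₂ be square matrices over R (possibly of different sizes p₁, p₂), all of whose entries lie in the maximal ideal, with det(M₁), det(M₂) nonzero. If the stabilized matrices 1_{k₁} ⊕ M₁ and 1_{k₂} ⊕ M₂ are equivalent (equal size: k₁ + p₁ = k₂ + p₂), then p₁ = p₂ and M₁ is equivalent to M₂. -/

import Mathlib

open Matrix in
/-- The rank of the block matrix `1 ⊕ 0`. -/
theorem rank_fromBlocks_one_zero {K m n : Type*} [Field K] [Fintype m] [Fintype n]
    [DecidableEq m] [DecidableEq n] :
    (fromBlocks (1 : Matrix m m K) 0 0 (0 : Matrix n n K)).rank = Fintype.card m := by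
  classical
  have h : fromBlocks (1 : Matrix m m K) 0 0 (0 : Matrix n n K) =
      diagonal (Sum.elim (fun _ => 1) (fun _ => 0)) := by
    rw [← diagonal_one, ← diagonal_zero, fromBlocks_diagonal]
  rw [h, rank_diagonal, Fintype.card_subtype, Finset.card_filter, Fintype.sum_sum_type]
  simp

open Matrix in
theorem map_residue_eq_zero {R m n : Type*} [CommRing R] [IsLocalRing R] {M : Matrix m n R}
    (hM : ∀ i j, M i j ∈ IsLocalRing.maximalIdeal R) :
    M.map (IsLocalRing.residue R) = 0 := by
  ext i j
  exact (IsLocalRing.residue_eq_zero_iff _).2 (hM i j)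

open Matrix in
theorem isUnit_det_map_residue_iff {R n : Type*} [CommRing R] [IsLocalRing R] [Fintype n]
    [DecidableEq n] {M : Matrix n n R} :
    IsUnit (M.map (IsLocalRing.residue R)).det ↔ IsUnit M.det := by
  rw [← RingHom.mapMatrix_apply, ← RingHom.map_det, isUnit_map_iff]

open Matrix in
/-- Over a local ring, an equivalence between stabilizations by the same identity block of two
matrices with entries in the maximal ideal restricts to an equivalence of the matrices. -/
theorem exists_equiv_of_fromBlocks_one_equiv {R m n : Type*} [CommRing R] [IsLocalRing R]
    [Fintype m] [Fintype n] [DecidableEq m] [DecidableEq n] {M₁ M₂ : Matrix n n R}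
    (hm₁ : ∀ i j, M₁ i j ∈ IsLocalRing.maximalIdeal R)
    (hm₂ : ∀ i j, M₂ i j ∈ IsLocalRing.maximalIdeal R)
    {A B : Matrix (m ⊕ n) (m ⊕ n) R} (hA : IsUnit A.det) (hB : IsUnit B.det)
    (h : fromBlocks 1 0 0 M₁ = A * fromBlocks 1 0 0 M₂ * B) :
    ∃ C D : Matrix n n R, IsUnit C.det ∧ IsUnit D.det ∧ M₁ = C * M₂ * D := by
  have hU : A⁻¹ * fromBlocks 1 0 0 M₁ = fromBlocks 1 0 0 M₂ * B := by
    rw [h, Matrix.mul_assoc, nonsing_inv_mul_cancel_left _ _ hA]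
  have hUd : IsUnit (A⁻¹).det := isUnit_nonsing_inv_det A hA
  generalize A⁻¹ = U at hU hUd
  rw [← fromBlocks_toBlocks U, ← fromBlocks_toBlocks B, fromBlocks_multiply,
    fromBlocks_multiply, fromBlocks_inj] at hU
  simp only [Matrix.mul_one, Matrix.one_mul, Matrix.mul_zero, Matrix.zero_mul, add_zero,
    zero_add] at hU
  obtain ⟨-, h₁₂, h₂₁, h₂₂⟩ := hU
  have hd : IsUnit U.toBlocks₂₂.det := by
    have h0 : U.toBlocks₂₁.map (IsLocalRing.residue R) = 0 := by
      rw [h₂₁, Matrix.map_mul, map_residue_eq_zero hm₂, Matrix.zero_mul]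
    rw [← isUnit_det_map_residue_iff, ← fromBlocks_toBlocks U, fromBlocks_map, h0,
      det_fromBlocks_zero₂₁] at hUd
    exact isUnit_det_map_residue_iff.1 (isUnit_of_mul_isUnit_right hUd)
  have hh : IsUnit B.toBlocks₂₂.det := by
    have h0 : B.toBlocks₁₂.map (IsLocalRing.residue R) = 0 := by
      rw [← h₁₂, Matrix.map_mul, map_residue_eq_zero hm₁, Matrix.mul_zero]
    rw [← isUnit_det_map_residue_iff, ← fromBlocks_toBlocks B, fromBlocks_map, h0,
      det_fromBlocks_zero₁₂] at hB
    exact isUnit_det_map_residue_iff.1 (isUnit_of_mul_isUnit_right hB)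
  refine ⟨U.toBlocks₂₂⁻¹, B.toBlocks₂₂, isUnit_nonsing_inv_det _ hd, hh, ?_⟩
  rw [Matrix.mul_assoc, ← h₂₂, nonsing_inv_mul_cancel_left _ _ hd]

/-- stable equivalence of matrices (with entries in the maximal ideal of a
Noetherian local ring) implies equivalence. -/
theorem stmt7 {R : Type*} [CommRing R] [IsLocalRing R] [IsNoetherianRing R]
    {p₁ p₂ k₁ k₂ : ℕ}
    (M₁ : Matrix (Fin p₁) (Fin p₁) R) (M₂ : Matrix (Fin p₂) (Fin p₂) R)
    (hm₁ : ∀ i j, M₁ i j ∈ IsLocalRing.maximalIdeal R)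
    (hm₂ : ∀ i j, M₂ i j ∈ IsLocalRing.maximalIdeal R)
    (hd₁ : M₁.det ≠ 0) (hd₂ : M₂.det ≠ 0)
    (hsize : k₁ + p₁ = k₂ + p₂)
    (heq : ∃ A B : Matrix (Fin (k₁ + p₁)) (Fin (k₁ + p₁)) R, IsUnit A.det ∧ IsUnit B.det ∧
      Matrix.reindex finSumFinEquiv finSumFinEquiv
          (Matrix.fromBlocks (1 : Matrix (Fin k₁) (Fin k₁) R) 0 0 M₁) =
        A * Matrix.reindex (finSumFinEquiv.trans (finCongr hsize.symm))
            (finSumFinEquiv.trans (finCongr hsize.symm))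
            (Matrix.fromBlocks (1 : Matrix (Fin k₂) (Fin k₂) R) 0 0 M₂) * B) :
    p₁ = p₂ ∧ ∃ (h : p₁ = p₂) (A B : Matrix (Fin p₁) (Fin p₁) R),
      IsUnit A.det ∧ IsUnit B.det ∧
      M₁ = A * Matrix.reindex (finCongr h.symm) (finCongr h.symm) M₂ * B := by
  obtain ⟨A, B, hA, hB, h⟩ := heq
  have hk : k₁ = k₂ := by
    have hr := congrArg (fun M => (M.map (IsLocalRing.residue R)).rank) h
    simp only [Matrix.map_mul] at hr
    rw [Matrix.rank_mul_eq_left_of_isUnit_det _ _ (isUnit_det_map_residue_iff.2 hB),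
      Matrix.rank_mul_eq_right_of_isUnit_det _ _ (isUnit_det_map_residue_iff.2 hA)] at hr
    rw [Matrix.reindex_apply, Matrix.reindex_apply, ← Matrix.submatrix_map,
      ← Matrix.submatrix_map, Matrix.rank_submatrix, Matrix.rank_submatrix,
      Matrix.fromBlocks_map, Matrix.fromBlocks_map, map_residue_eq_zero hm₁,
      map_residue_eq_zero hm₂] at hr
    simpa [rank_fromBlocks_one_zero] using hr
  have hp : p₁ = p₂ := by omega
  subst hk hp
  refine ⟨rfl, rfl, ?_⟩
  let e : Fin k₁ ⊕ Fin p₁ ≃ Fin (k₁ + p₁) := finSumFinEquiv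
  have h' : Matrix.fromBlocks 1 0 0 M₁ =
      A.submatrix e e * Matrix.fromBlocks 1 0 0 M₂ * B.submatrix e e := by
    have := congrArg (fun M => M.submatrix e e) h
    simp only [← Matrix.submatrix_mul_equiv _ _ _ e _] at this
    simpa only [e, Matrix.reindex_apply, Matrix.submatrix_submatrix, finCongr_refl,
      Equiv.trans_refl, Equiv.symm_comp_self, Matrix.submatrix_id_id] using this
  simpa using exists_equiv_of_fromBlocks_one_equiv hm₁ hm₂
    (by rwa [Matrix.det_submatrix_equiv_self]) (by rwa [Matrix.det_submatrix_equiv_self]) h'
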